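/- arXiv:1712.02168 — 2 statements merged into one kernel-verified Lean document; each statement's English description precedes it below -/
import Mathlib

section
/- For every A ∈ SL(2,ℂ) and every x ∈ ℝ⁴, the map Φ(A) is ℝ-linear and preserves the Minkowski norm: ‖Φ(A)(x)‖² = ‖x‖², i.e. Φ(A) is a Lorentz transformation. -/
open Matrix Complex Finset

/-- The Pauli matrices σ₀, σ₁, σ₂, σ₃. -/
noncomputable def σm : Fin 4 → Matrix (Fin 2) (Fin 2) ℂ :=
  ![!![1, 0; 0, 1], !![0, 1; 1, 0], !![0, -I; I, 0], !![1, 0; 0, -1]]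

/-- The totally antisymmetric symbol with ε₁₂₃ = 1 (on indices in {1,2,3} ⊂ {0,1,2,3}). -/
noncomputable def eps (i j k : Fin 4) : ℂ :=
  if (i, j, k) = (1, 2, 3) ∨ (i, j, k) = (2, 3, 1) ∨ (i, j, k) = (3, 1, 2) then 1
  else if (i, j, k) = (1, 3, 2) ∨ (i, j, k) = (3, 2, 1) ∨ (i, j, k) = (2, 1, 3) then -1
  else 0

/-- Ψ : ℝ⁴ → M₂(ℂ), Ψ(x) = ∑ xⁱ σᵢ. -/
noncomputable def Ψ (x : Fin 4 → ℝ) : Matrix (Fin 2) (Fin 2) ℂ :=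
  ∑ i, (x i : ℂ) • σm i

/-- The conjugated matrix A' = tr(A)·σ₀ − A (i.e. a⁰σ₀ − a¹σ₁ − a²σ₂ − a³σ₃). -/
noncomputable def matConj (A : Matrix (Fin 2) (Fin 2) ℂ) : Matrix (Fin 2) (Fin 2) ℂ :=
  A.trace • (1 : Matrix (Fin 2) (Fin 2) ℂ) - A

/-- The inverse of Ψ (on Hermitian matrices): xⁱ = Re((1/2)·tr(σᵢ M)). -/
noncomputable def ΨInv (M : Matrix (Fin 2) (Fin 2) ℂ) : Fin 4 → ℝ :=
  fun i => ((1 / 2 : ℂ) * (σm i * M).trace).re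

/-- Φ(A)(x) = Ψ⁻¹(A Ψ(x) A†). -/
noncomputable def Φ (A : Matrix (Fin 2) (Fin 2) ℂ) (x : Fin 4 → ℝ) : Fin 4 → ℝ :=
  ΨInv (A * Ψ x * Aᴴ)

/-- The Minkowski norm ‖x‖² = (x⁰)² − (x¹)² − (x²)² − (x³)². -/
def mink (x : Fin 4 → ℝ) : ℝ := x 0 ^ 2 - x 1 ^ 2 - x 2 ^ 2 - x 3 ^ 2

/-- The Minkowski metric g = diag(1,−1,−1,−1). -/
def gM : Matrix (Fin 4) (Fin 4) ℝ := Matrix.diagonal ![1, -1, -1, -1]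

/-- τ₍ᵢ₎(T) = ∑_{j,k} Tʲₖ σᵢ' σⱼ σᵢ σₖ. -/
noncomputable def τm (T : Matrix (Fin 4) (Fin 4) ℝ) (i : Fin 4) : Matrix (Fin 2) (Fin 2) ℂ :=
  ∑ j, ∑ k, (T j k : ℂ) • (matConj (σm i) * σm j * σm i * σm k)

/-- The ℂ-linear extension of Ψ⁻¹: component i is (1/2)·tr(σᵢ M). -/
noncomputable def ΨInvC (M : Matrix (Fin 2) (Fin 2) ℂ) : Fin 4 → ℂ :=
  fun i => (1 / 2 : ℂ) * (σm i * M).trace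

lemma Ψ_eq (x : Fin 4 → ℝ) :
    Ψ x = !![(x 0 : ℂ) + x 3, x 1 - x 2 * I; x 1 + x 2 * I, x 0 - x 3] := by
  ext i j
  fin_cases i <;> fin_cases j <;> simp [Ψ, σm, Fin.sum_univ_four, sub_eq_add_neg]

lemma isHermitian_Ψ (x : Fin 4 → ℝ) : (Ψ x).IsHermitian := by
  rw [Ψ_eq]
  ext i j
  fin_cases i <;> fin_cases j <;> simp [sub_eq_add_neg]

lemma det_Ψ (x : Fin 4 → ℝ) : (Ψ x).det = (mink x : ℂ) := by
  rw [Ψ_eq, Matrix.det_fin_two_of]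
  simp only [mink]
  push_cast
  linear_combination (x 2 : ℂ) ^ 2 * I_sq

lemma Ψ_ΨInv {M : Matrix (Fin 2) (Fin 2) ℂ} (hM : M.IsHermitian) : Ψ (ΨInv M) = M := by
  have h00 := congrArg Complex.im (hM.apply 0 0)
  have h11 := congrArg Complex.im (hM.apply 1 1)
  have h01 := hM.apply 0 1
  have hre := congrArg Complex.re h01
  have him := congrArg Complex.im h01
  simp only [star_def, conj_re, conj_im] at h00 h11 hre him
  rw [Ψ_eq]
  ext i j
  fin_cases i <;> fin_cases j <;> apply Complex.ext <;>
    simp [ΨInv, σm, Matrix.trace_fin_two, Matrix.vecMul, dotProduct] <;> linarith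

lemma Ψ_add (x y : Fin 4 → ℝ) : Ψ (x + y) = Ψ x + Ψ y := by
  simp [Ψ, add_smul, Finset.sum_add_distrib]

lemma Ψ_smul (c : ℝ) (x : Fin 4 → ℝ) : Ψ (c • x) = c • Ψ x := by
  simp only [Ψ, Finset.smul_sum, Pi.smul_apply, smul_eq_mul, ofReal_mul, mul_smul, Complex.coe_smul]

lemma ΨInv_add (M N : Matrix (Fin 2) (Fin 2) ℂ) : ΨInv (M + N) = ΨInv M + ΨInv N := by
  ext i
  simp only [ΨInv, Matrix.trace_add, mul_add, Complex.add_re, Pi.add_apply]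

lemma ΨInv_smul (c : ℝ) (M : Matrix (Fin 2) (Fin 2) ℂ) : ΨInv (c • M) = c • ΨInv M := by
  ext i
  simp only [ΨInv, Matrix.trace_smul, mul_smul_comm, Complex.smul_re,
    Pi.smul_apply]

lemma Ψ_Φ (A : Matrix (Fin 2) (Fin 2) ℂ) (x : Fin 4 → ℝ) : Ψ (Φ A x) = A * Ψ x * Aᴴ :=
  Ψ_ΨInv (Matrix.isHermitian_mul_mul_conjTranspose A (isHermitian_Ψ x))

/-- For A ∈ SL(2,ℂ), Φ(A) is ℝ-linear and preserves the Minkowski norm. -/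
theorem Phi_is_lorentz (A : Matrix (Fin 2) (Fin 2) ℂ) (hA : A.det = 1) :
    (∀ x y : Fin 4 → ℝ, Φ A (x + y) = Φ A x + Φ A y) ∧
      (∀ (c : ℝ) (x : Fin 4 → ℝ), Φ A (c • x) = c • Φ A x) ∧
      (∀ x : Fin 4 → ℝ, mink (Φ A x) = mink x) := by
  refine ⟨fun x y => ?_, fun c x => ?_, fun x => ?_⟩
  · simp only [Φ, Ψ_add, Matrix.mul_add, Matrix.add_mul, ΨInv_add]
  · simp only [Φ, Ψ_smul, Matrix.mul_smul, Matrix.smul_mul, ΨInv_smul]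
  · apply Complex.ofReal_injective
    rw [← det_Ψ, ← det_Ψ, Ψ_Φ, Matrix.det_mul, Matrix.det_mul, Matrix.det_conjTranspose, hA]
    simp
end

section
/- Let A = ∑_{i=0}^{3} aⁱσᵢ ∈ SL(2,ℂ) and let T = Φ(A) be the induced special Lorentz transformation. Then for each i ∈ {0,1,2,3}, τ₍ᵢ₎(T) = 4 āⁱ σᵢ' A, where āⁱ is the complex conjugate of aⁱ. -/
open Matrix Complex Finset

theorem conjTranspose_σm (i : Fin 4) : (σm i)ᴴ = σm i := by
  ext p q
  fin_cases i <;> fin_cases p <;> fin_cases q <;> simp [σm]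

/-- The expansion of a matrix in the Pauli basis. -/
theorem sum_trace_smul_σm (M : Matrix (Fin 2) (Fin 2) ℂ) :
    ∑ j, (σm j * M).trace • σm j = (2 : ℂ) • M := by
  ext p q
  fin_cases p <;> fin_cases q <;>
    simp [σm, Fin.sum_univ_four, Matrix.trace, Matrix.mul_apply, Fin.sum_univ_two] <;>
    grind [I_mul_I]

theorem sum_σm_mul_mul_σm (M : Matrix (Fin 2) (Fin 2) ℂ) :
    ∑ k, σm k * M * σm k = (2 * M.trace) • (1 : Matrix (Fin 2) (Fin 2) ℂ) := by
  rw [Matrix.eta_fin_two M]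
  ext p q
  fin_cases p <;> fin_cases q <;>
    simp [σm, Fin.sum_univ_four, Matrix.trace, Fin.sum_univ_two] <;>
    grind [I_mul_I]

theorem trace_σm_mul_σm (i j : Fin 4) :
    (σm i * σm j).trace = if i = j then 2 else 0 := by
  fin_cases i <;> fin_cases j <;>
    simp [σm, Matrix.trace, Fin.sum_univ_two] <;> norm_num

theorem trace_conjTranspose_mul_σm (a : Fin 4 → ℂ) (i : Fin 4) :
    ((∑ j, a j • σm j)ᴴ * σm i).trace = 2 * (starRingEnd ℂ) (a i) := by
  simp [Matrix.conjTranspose_sum, conjTranspose_σm, Finset.sum_mul, Matrix.trace_sum,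
    trace_σm_mul_σm, mul_comm]

/-- `Ψ⁻¹` loses nothing by taking real parts on Hermitian matrices. -/
theorem ofReal_ΨInv {M : Matrix (Fin 2) (Fin 2) ℂ} (hM : M.IsHermitian) (i : Fin 4) :
    (ΨInv M i : ℂ) = 1 / 2 * (σm i * M).trace := by
  refine conj_eq_iff_re.mp ?_
  have h : (starRingEnd ℂ) (σm i * M).trace = (σm i * M).trace := by
    rw [starRingEnd_apply, ← Matrix.trace_conjTranspose, Matrix.conjTranspose_mul,
      conjTranspose_σm, hM.eq, Matrix.trace_mul_comm]
  rw [map_mul, h]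
  simp [Complex.conj_ofNat]

theorem isHermitian_mul_σm_mul_conjTranspose (A : Matrix (Fin 2) (Fin 2) ℂ) (k : Fin 4) :
    (A * σm k * Aᴴ).IsHermitian :=
  Matrix.isHermitian_mul_mul_conjTranspose A (conjTranspose_σm k)

theorem Ψ_single (k : Fin 4) : Ψ (Pi.single k 1) = σm k := by
  simp [Ψ, Pi.single_apply]

/-- For A = ∑ aⁱσᵢ ∈ SL(2,ℂ) and T = Φ(A): τ₍ᵢ₎(T) = 4 āⁱ σᵢ' A. -/
theorem tau_of_Phi (a : Fin 4 → ℂ) (A : Matrix (Fin 2) (Fin 2) ℂ)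
    (hAa : A = ∑ i, a i • σm i) (hA : A.det = 1)
    (T : Matrix (Fin 4) (Fin 4) ℝ)
    (hT : ∀ (x : Fin 4 → ℝ) (i : Fin 4), Φ A x i = ∑ j, T i j * x j)
    (i : Fin 4) :
    τm T i = (4 * (starRingEnd ℂ) (a i)) • (matConj (σm i) * A) := by
  have hT' (j k : Fin 4) : (T j k : ℂ) = 1 / 2 * (σm j * (A * σm k * Aᴴ)).trace := by
    have h := hT (Pi.single k 1) j
    rw [Φ, Ψ_single] at h
    rw [← ofReal_ΨInv (isHermitian_mul_σm_mul_conjTranspose A k), h]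
    simp [Pi.single_apply]
  have hcol (k : Fin 4) : ∑ j, (T j k : ℂ) • σm j = A * σm k * Aᴴ := by
    simp_rw [hT', mul_smul]
    rw [← Finset.smul_sum, sum_trace_smul_σm, smul_smul]
    norm_num
  calc τm T i
      = ∑ k, matConj (σm i) * (∑ j, (T j k : ℂ) • σm j) * σm i * σm k := by
        rw [τm, Finset.sum_comm]
        simp [Finset.mul_sum, Finset.sum_mul]
    _ = matConj (σm i) * A * ∑ k, σm k * (Aᴴ * σm i) * σm k := by
        simp_rw [hcol, Finset.mul_sum, Matrix.mul_assoc]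
    _ = (4 * (starRingEnd ℂ) (a i)) • (matConj (σm i) * A) := by
        rw [sum_σm_mul_mul_σm, hAa, trace_conjTranspose_mul_σm, Matrix.mul_smul, Matrix.mul_one,
          ← mul_assoc]
        norm_num
end
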